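/- Let A and B be graded unital 𝕜-algebras. If the 𝕜-linear map τ: B⊗A → A⊗B is graded twisting to degree n, then there is a 𝕜-algebra homomorphism φ: (A*B)/I_τⁿ → (A⊗B)/(A⊗B)_{>n} (where the algebra structure on the target is the one induced by μ_τ), and φ is an isomorphism in all degrees ≤ n. Moreover, if τ is a graded twisting map, then A⊗_τB ≅ (A*B)/I_τ as graded algebras. -/

import Mathlib

open TensorProduct

noncomputable section

namespace TTP

variable (𝕜 : Type) [Field 𝕜]

/-- The image of `p ⊗ q` inside `M ⊗[𝕜] N`, for submodules `p ⊆ M`, `q ⊆ N`. -/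
def subTmul {M N : Type} [AddCommGroup M] [Module 𝕜 M] [AddCommGroup N] [Module 𝕜 N]
    (p : Submodule 𝕜 M) (q : Submodule 𝕜 N) : Submodule 𝕜 (M ⊗[𝕜] N) :=
  LinearMap.range (TensorProduct.map p.subtype q.subtype)

/-- The Künneth grading on a tensor product of graded vector spaces. -/
def kunneth {M N : Type} [AddCommGroup M] [Module 𝕜 M] [AddCommGroup N] [Module 𝕜 N]
    (𝒜 : ℕ → Submodule 𝕜 M) (ℬ : ℕ → Submodule 𝕜 N) (n : ℕ) : Submodule 𝕜 (M ⊗[𝕜] N) :=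
  ⨆ (pq : ℕ × ℕ) (_ : pq.1 + pq.2 = n), subTmul 𝕜 (𝒜 pq.1) (ℬ pq.2)

/-- The positive part `X₊ = ⊕_{i>0} X_i` of a graded vector space. -/
def plusPart {M : Type} [AddCommGroup M] [Module 𝕜 M] (𝒜 : ℕ → Submodule 𝕜 M) :
    Submodule 𝕜 M :=
  ⨆ (i : ℕ) (_ : 0 < i), 𝒜 i

/-- The grading concentrating `𝒜 1` in degree `1` (and `⊥` elsewhere). -/
def degOne {M : Type} [AddCommGroup M] [Module 𝕜 M] (𝒜 : ℕ → Submodule 𝕜 M) :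
    ℕ → Submodule 𝕜 M :=
  fun n => if n = 1 then 𝒜 1 else ⊥

variable (A B : Type) [Ring A] [Algebra 𝕜 A] [Ring B] [Algebra 𝕜 B]

/-- `τ ∘ (μ_B ⊗ μ_A)` on `(B ⊗ B) ⊗ (A ⊗ A)`. -/
def twistLHS (τ : B ⊗[𝕜] A →ₗ[𝕜] A ⊗[𝕜] B) :
    (B ⊗[𝕜] B) ⊗[𝕜] (A ⊗[𝕜] A) →ₗ[𝕜] A ⊗[𝕜] B :=
  τ ∘ₗ TensorProduct.map (LinearMap.mul' 𝕜 B) (LinearMap.mul' 𝕜 A)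

/-- `(μ_A ⊗ μ_B) ∘ (1_A ⊗ τ ⊗ 1_B) ∘ (τ ⊗ τ) ∘ (1_B ⊗ τ ⊗ 1_A)` on `(B ⊗ B) ⊗ (A ⊗ A)`. -/
def twistRHS (τ : B ⊗[𝕜] A →ₗ[𝕜] A ⊗[𝕜] B) :
    (B ⊗[𝕜] B) ⊗[𝕜] (A ⊗[𝕜] A) →ₗ[𝕜] A ⊗[𝕜] B :=
  TensorProduct.map (LinearMap.mul' 𝕜 A) (LinearMap.mul' 𝕜 B)
    ∘ₗ (TensorProduct.assoc 𝕜 A A (B ⊗[𝕜] B)).symm.toLinearMap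
    ∘ₗ LinearMap.lTensor A (TensorProduct.assoc 𝕜 A B B).toLinearMap
    ∘ₗ LinearMap.lTensor A (LinearMap.rTensor B τ)
    ∘ₗ LinearMap.lTensor A (TensorProduct.assoc 𝕜 B A B).symm.toLinearMap
    ∘ₗ (TensorProduct.assoc 𝕜 A B (A ⊗[𝕜] B)).toLinearMap
    ∘ₗ TensorProduct.map τ τ
    ∘ₗ (TensorProduct.assoc 𝕜 B A (B ⊗[𝕜] A)).symm.toLinearMap
    ∘ₗ LinearMap.lTensor B (TensorProduct.assoc 𝕜 A B A).toLinearMap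
    ∘ₗ LinearMap.lTensor B (LinearMap.rTensor A τ)
    ∘ₗ LinearMap.lTensor B (TensorProduct.assoc 𝕜 B A A).symm.toLinearMap
    ∘ₗ (TensorProduct.assoc 𝕜 B B (A ⊗[𝕜] A)).toLinearMap

/-- `τ : B ⊗ A → A ⊗ B` is an (algebra) twisting map: it satisfies the unital twisting
conditions and `τ(μ_B ⊗ μ_A) = (μ_A ⊗ μ_B)(1_A ⊗ τ ⊗ 1_B)(τ ⊗ τ)(1_B ⊗ τ ⊗ 1_A)`. -/
def IsTwisting (τ : B ⊗[𝕜] A →ₗ[𝕜] A ⊗[𝕜] B) : Prop :=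
  (∀ a : A, τ ((1 : B) ⊗ₜ[𝕜] a) = a ⊗ₜ[𝕜] (1 : B)) ∧
  (∀ b : B, τ (b ⊗ₜ[𝕜] (1 : A)) = (1 : A) ⊗ₜ[𝕜] b) ∧
  twistLHS 𝕜 A B τ = twistRHS 𝕜 A B τ

/-- `τ` preserves the Künneth grading. -/
def IsGradedMapBA (𝒜 : ℕ → Submodule 𝕜 A) (ℬ : ℕ → Submodule 𝕜 B)
    (τ : B ⊗[𝕜] A →ₗ[𝕜] A ⊗[𝕜] B) : Prop :=
  ∀ n, Submodule.map τ (kunneth 𝕜 ℬ 𝒜 n) ≤ kunneth 𝕜 𝒜 ℬ n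

/-- `τ` is a graded twisting map. -/
def IsGradedTwisting (𝒜 : ℕ → Submodule 𝕜 A) (ℬ : ℕ → Submodule 𝕜 B)
    (τ : B ⊗[𝕜] A →ₗ[𝕜] A ⊗[𝕜] B) : Prop :=
  IsTwisting 𝕜 A B τ ∧ IsGradedMapBA 𝕜 A B 𝒜 ℬ τ

/-- A graded linear map `τ` is graded twisting to degree `n`:  it satisfies the unital
conditions and the twisting identity in all (Künneth) degrees `≤ n`. -/
def TwistingToDeg (𝒜 : ℕ → Submodule 𝕜 A) (ℬ : ℕ → Submodule 𝕜 B)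
    (τ : B ⊗[𝕜] A →ₗ[𝕜] A ⊗[𝕜] B) (n : ℕ) : Prop :=
  IsGradedMapBA 𝕜 A B 𝒜 ℬ τ ∧
  (∀ j ≤ n, ∀ a ∈ 𝒜 j, τ ((1 : B) ⊗ₜ[𝕜] a) = a ⊗ₜ[𝕜] (1 : B)) ∧
  (∀ j ≤ n, ∀ b ∈ ℬ j, τ (b ⊗ₜ[𝕜] (1 : A)) = (1 : A) ⊗ₜ[𝕜] b) ∧
  (∀ j ≤ n, ∀ x ∈ kunneth 𝕜 (kunneth 𝕜 ℬ ℬ) (kunneth 𝕜 𝒜 𝒜) j,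
    twistLHS 𝕜 A B τ x = twistRHS 𝕜 A B τ x)

/-- The unique extension property of a graded twisting map:  for every `n ≥ 3`, any
linear map `τ'` that is graded twisting to degree `n` and agrees with `τ` in all degrees
`< n` also agrees with `τ` in degree `n`. -/
def UEP (𝒜 : ℕ → Submodule 𝕜 A) (ℬ : ℕ → Submodule 𝕜 B)
    (τ : B ⊗[𝕜] A →ₗ[𝕜] A ⊗[𝕜] B) : Prop :=
  ∀ n, 3 ≤ n → ∀ τ' : B ⊗[𝕜] A →ₗ[𝕜] A ⊗[𝕜] B,
    TwistingToDeg 𝕜 A B 𝒜 ℬ τ' n →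
    (∀ i < n, ∀ x ∈ kunneth 𝕜 ℬ 𝒜 i, τ' x = τ x) →
    ∀ x ∈ kunneth 𝕜 ℬ 𝒜 n, τ' x = τ x

/-- The multiplication `μ_τ = (μ_A ⊗ μ_B)(1_A ⊗ τ ⊗ 1_B)` on `A ⊗ B`. -/
def mulTau (τ : B ⊗[𝕜] A →ₗ[𝕜] A ⊗[𝕜] B) :
    (A ⊗[𝕜] B) ⊗[𝕜] (A ⊗[𝕜] B) →ₗ[𝕜] A ⊗[𝕜] B :=
  TensorProduct.map (LinearMap.mul' 𝕜 A) (LinearMap.mul' 𝕜 B)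
    ∘ₗ (TensorProduct.assoc 𝕜 A A (B ⊗[𝕜] B)).symm.toLinearMap
    ∘ₗ LinearMap.lTensor A (TensorProduct.assoc 𝕜 A B B).toLinearMap
    ∘ₗ LinearMap.lTensor A (LinearMap.rTensor B τ)
    ∘ₗ LinearMap.lTensor A (TensorProduct.assoc 𝕜 B A B).symm.toLinearMap
    ∘ₗ (TensorProduct.assoc 𝕜 A B (A ⊗[𝕜] B)).toLinearMap

/-- `(C, ψ)` realizes the twisted tensor product algebra `A ⊗_τ B`:  `ψ` is a linear
isomorphism carrying the multiplication `μ_τ` and its unit to those of `C`. -/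
def Realizes (τ : B ⊗[𝕜] A →ₗ[𝕜] A ⊗[𝕜] B) (C : Type) [Ring C] [Algebra 𝕜 C]
    (ψ : A ⊗[𝕜] B →ₗ[𝕜] C) : Prop :=
  Function.Bijective ψ ∧ ψ ((1 : A) ⊗ₜ[𝕜] (1 : B)) = 1 ∧
  ∀ x y : A ⊗[𝕜] B, ψ (mulTau 𝕜 A B τ (x ⊗ₜ[𝕜] y)) = ψ x * ψ y

/-- The two-sided ideal generated by a subset, as a `𝕜`-submodule. -/
def idealSpan (C : Type) [Ring C] [Algebra 𝕜 C] (s : Set C) : Submodule 𝕜 C :=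
  Submodule.span 𝕜 {x | ∃ c d r, r ∈ s ∧ x = c * r * d}

/-- Weight grading of the tensor algebra. -/
def tensorWeight (V : Type) [AddCommGroup V] [Module 𝕜 V] (n : ℕ) :
    Submodule 𝕜 (TensorAlgebra 𝕜 V) :=
  LinearMap.range (TensorAlgebra.ι 𝕜 (M := V)) ^ n

instance (V : Type) [AddCommGroup V] [Module 𝕜 V] : GradedAlgebra (tensorWeight 𝕜 V) :=
  inferInstanceAs (GradedAlgebra
    ((LinearMap.range (TensorAlgebra.ι 𝕜 : V →ₗ[𝕜] TensorAlgebra 𝕜 V) ^ ·) : ℕ → Submodule 𝕜 _))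

/-- The canonical map `T(C₁) → C` for a graded algebra `C`. -/
def canMap (C : Type) [Ring C] [Algebra 𝕜 C] (𝒞 : ℕ → Submodule 𝕜 C) :
    TensorAlgebra 𝕜 ↥(𝒞 1) →ₐ[𝕜] C :=
  TensorAlgebra.lift 𝕜 (𝒞 1).subtype

/-- `C` (with grading `𝒞`) is a quadratic algebra: the canonical map `T(C₁) → C` is
surjective and its kernel is generated, as a two-sided ideal, by its degree 2 part. -/
def IsQuadraticAlg (C : Type) [Ring C] [Algebra 𝕜 C] (𝒞 : ℕ → Submodule 𝕜 C) : Prop :=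
  Function.Surjective (canMap 𝕜 C 𝒞) ∧
  LinearMap.ker (canMap 𝕜 C 𝒞).toLinearMap =
    idealSpan 𝕜 (TensorAlgebra 𝕜 ↥(𝒞 1))
      ((LinearMap.ker (canMap 𝕜 C 𝒞).toLinearMap ⊓ tensorWeight 𝕜 ↥(𝒞 1) 2 : Submodule 𝕜 _) : Set _)

/-- The left ideal generated by the positive part of a graded algebra. -/
def augIdeal (C : Type) [Ring C] [Algebra 𝕜 C] (𝒞 : ℕ → Submodule 𝕜 C) : Submodule C C :=
  Submodule.span C {x : C | ∃ i, 0 < i ∧ x ∈ 𝒞 i}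

/-- The degree `n` component of the graded free module on generators `σ` in degree `i`. -/
def freeGrade (C : Type) [Ring C] [Algebra 𝕜 C] (𝒞 : ℕ → Submodule 𝕜 C)
    (i : ℕ) (σ : Type) (n : ℕ) : Submodule 𝕜 (σ →₀ C) :=
  ⨅ (j : σ), Submodule.comap (Finsupp.lapply j : (σ →₀ C) →ₗ[𝕜] C)
    (if i ≤ n then 𝒞 (n - i) else ⊥)

/-- `C` (with grading `𝒞`) is a Koszul algebra: the trivial module `𝕜 = C/C₊` admits a
resolution by graded free modules with the `i`-th term generated in degree `i`. -/
def IsKoszul (C : Type) [Ring C] [Algebra 𝕜 C] (𝒞 : ℕ → Submodule 𝕜 C) : Prop :=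
  ∃ (σ : ℕ → Type) (d : ∀ i : ℕ, ((σ (i + 1)) →₀ C) →ₗ[C] ((σ i) →₀ C))
    (ε : ((σ 0) →₀ C) →ₗ[C] (C ⧸ augIdeal 𝕜 C 𝒞)),
    Function.Surjective ε ∧
    LinearMap.ker ε = LinearMap.range (d 0) ∧
    (∀ i, LinearMap.ker (d i) = LinearMap.range (d (i + 1))) ∧
    (∀ i n, ∀ x ∈ freeGrade 𝕜 C 𝒞 (i + 1) (σ (i + 1)) n, d i x ∈ freeGrade 𝕜 C 𝒞 i (σ i) n) ∧
    (∀ n, 0 < n → ∀ x ∈ freeGrade 𝕜 C 𝒞 0 (σ 0) n, ε x = 0)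

/-- `(P, ιA, ιB)` is a free product (coproduct) of `A` and `B`. -/
def IsFreeProduct (P : Type) [Ring P] [Algebra 𝕜 P] (ιA : A →ₐ[𝕜] P) (ιB : B →ₐ[𝕜] P) :
    Prop :=
  ∀ (C : Type) [Ring C] [Algebra 𝕜 C], ∀ (f : A →ₐ[𝕜] C) (g : B →ₐ[𝕜] C),
    ∃! h : P →ₐ[𝕜] C, h.comp ιA = f ∧ h.comp ιB = g

/-- The linear map `A ⊗ B → P`, `a ⊗ b ↦ ιA(a) · ιB(b)`. -/
def mulMapP (P : Type) [Ring P] [Algebra 𝕜 P] (ιA : A →ₐ[𝕜] P) (ιB : B →ₐ[𝕜] P) :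
    A ⊗[𝕜] B →ₗ[𝕜] P :=
  TensorProduct.lift (LinearMap.mk₂ 𝕜 (fun a b => ιA a * ιB b)
    (fun a a' b => by simp [map_add, add_mul])
    (fun c a b => by simp [map_smul, smul_mul_assoc])
    (fun a b b' => by simp [map_add, mul_add])
    (fun c a b => by simp [map_smul, mul_smul_comm]))

/-- The set of `τ`-relations `b ⊗ a - τ(b ⊗ a)` of total degree at most `n`,
inside the free product `P`. -/
def relSetLe (P : Type) [Ring P] [Algebra 𝕜 P] (ιA : A →ₐ[𝕜] P) (ιB : B →ₐ[𝕜] P)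
    (𝒜 : ℕ → Submodule 𝕜 A) (ℬ : ℕ → Submodule 𝕜 B)
    (τ : B ⊗[𝕜] A →ₗ[𝕜] A ⊗[𝕜] B) (n : ℕ) : Set P :=
  {x | ∃ i j a b, i + j ≤ n ∧ a ∈ 𝒜 i ∧ b ∈ ℬ j ∧
    x = ιB b * ιA a - mulMapP 𝕜 A B P ιA ιB (τ (b ⊗ₜ[𝕜] a))}

/-- The set of all `τ`-relations `b ⊗ a - τ(b ⊗ a)` inside the free product `P`. -/
def relSetAll (P : Type) [Ring P] [Algebra 𝕜 P] (ιA : A →ₐ[𝕜] P) (ιB : B →ₐ[𝕜] P)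
    (τ : B ⊗[𝕜] A →ₗ[𝕜] A ⊗[𝕜] B) : Set P :=
  {x | ∃ a b, x = ιB b * ιA a - mulMapP 𝕜 A B P ιA ιB (τ (b ⊗ₜ[𝕜] a))}

/-- The (Künneth) grading on the free product `P` of the graded algebras `A` and `B`. -/
def freeProdGrade (P : Type) [Ring P] [Algebra 𝕜 P] (ιA : A →ₐ[𝕜] P) (ιB : B →ₐ[𝕜] P)
    (𝒜 : ℕ → Submodule 𝕜 A) (ℬ : ℕ → Submodule 𝕜 B) (n : ℕ) : Submodule 𝕜 P :=
  ⨆ (l : List ℕ) (_ : l.sum = n),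
    ((l.map (fun i => Submodule.map ιA.toLinearMap (𝒜 i) ⊔ Submodule.map ιB.toLinearMap (ℬ i))).foldr
      (· * ·) 1)

end TTP

namespace TTP

section Kunneth

variable {𝕜 : Type} [Field 𝕜]
variable {M N : Type} [AddCommGroup M] [Module 𝕜 M] [AddCommGroup N] [Module 𝕜 N]

lemma tmul_mem_kunneth {𝒜 : ℕ → Submodule 𝕜 M} {ℬ : ℕ → Submodule 𝕜 N} {i j : ℕ} {a : M} {b : N}
    (ha : a ∈ 𝒜 i) (hb : b ∈ ℬ j) : a ⊗ₜ[𝕜] b ∈ kunneth 𝕜 𝒜 ℬ (i + j) := by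
  have h : subTmul 𝕜 (𝒜 i) (ℬ j) ≤ kunneth 𝕜 𝒜 ℬ (i + j) :=
    le_iSup₂_of_le (f := fun (pq : ℕ × ℕ) (_ : pq.1 + pq.2 = i + j) =>
      subTmul 𝕜 (𝒜 pq.1) (ℬ pq.2)) (i, j) rfl le_rfl
  exact h ⟨⟨a, ha⟩ ⊗ₜ ⟨b, hb⟩, by simp⟩

lemma kunneth_le {𝒜 : ℕ → Submodule 𝕜 M} {ℬ : ℕ → Submodule 𝕜 N} {n : ℕ}
    {S : Submodule 𝕜 (M ⊗[𝕜] N)}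
    (h : ∀ i j, i + j = n → ∀ a ∈ 𝒜 i, ∀ b ∈ ℬ j, a ⊗ₜ[𝕜] b ∈ S) : kunneth 𝕜 𝒜 ℬ n ≤ S := by
  refine iSup₂_le fun pq hpq => ?_
  rintro _ ⟨z, rfl⟩
  induction z with
  | zero => simp
  | tmul a b => exact h _ _ hpq _ a.2 _ b.2
  | add x y hx hy => rw [map_add]; exact S.add_mem hx hy

lemma map_mem_kunneth {𝒜 : ℕ → Submodule 𝕜 M} {ℬ : ℕ → Submodule 𝕜 N} {i j k : ℕ}
    {f : M →ₗ[𝕜] M} {g : N →ₗ[𝕜] N}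
    (hf : ∀ l, ∀ a ∈ 𝒜 l, f a ∈ 𝒜 (i + l)) (hg : ∀ l, ∀ b ∈ ℬ l, g b ∈ ℬ (l + k))
    {x : M ⊗[𝕜] N} (hx : x ∈ kunneth 𝕜 𝒜 ℬ j) :
    TensorProduct.map f g x ∈ kunneth 𝕜 𝒜 ℬ (i + j + k) := by
  revert x
  change kunneth 𝕜 𝒜 ℬ j ≤ (kunneth 𝕜 𝒜 ℬ (i + j + k)).comap (TensorProduct.map f g)
  refine kunneth_le fun p r hpr a ha b hb => ?_
  have := tmul_mem_kunneth (hf p a ha) (hg r b hb)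
  rwa [show i + p + (r + k) = i + j + k by omega] at this

lemma kunneth_disjoint_iSup_gt (𝒜 : ℕ → Submodule 𝕜 M) (ℬ : ℕ → Submodule 𝕜 N)
    [DirectSum.Decomposition 𝒜] [DirectSum.Decomposition ℬ] {j n : ℕ} (hj : j ≤ n) :
    Disjoint (kunneth 𝕜 𝒜 ℬ j) (⨆ (m : ℕ) (_ : n < m), kunneth 𝕜 𝒜 ℬ m) := by
  have exists_proj : ∀ {V : Type} [AddCommGroup V] [Module 𝕜 V] (𝒱 : ℕ → Submodule 𝕜 V)
      [DirectSum.Decomposition 𝒱], ∃ p : ℕ → V →ₗ[𝕜] V,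
      ∀ i k, ∀ v ∈ 𝒱 i, p k v = if i = k then v else 0 := by
    intro V _ _ 𝒱 _
    refine ⟨fun k => (𝒱 k).subtype ∘ₗ DirectSum.component 𝕜 ℕ (fun i => 𝒱 i) k ∘ₗ
      (DirectSum.decomposeLinearEquiv 𝒱).toLinearMap, fun i k v hv => ?_⟩
    have : ((DirectSum.decompose 𝒱 v) k : V) = if i = k then v else 0 := by
      split_ifs with h
      · subst h; exact DirectSum.decompose_of_mem_same 𝒱 hv
      · exact DirectSum.decompose_of_mem_ne 𝒱 hv h
    exact this
  obtain ⟨p, hp⟩ := exists_proj 𝒜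
  obtain ⟨r, hr⟩ := exists_proj ℬ
  let π : M ⊗[𝕜] N →ₗ[𝕜] M ⊗[𝕜] N :=
    ∑ s ∈ Finset.HasAntidiagonal.antidiagonal j, TensorProduct.map (p s.1) (r s.2)
  have hπ : ∀ i k, ∀ a ∈ 𝒜 i, ∀ b ∈ ℬ k,
      π (a ⊗ₜ[𝕜] b) = if i + k = j then a ⊗ₜ[𝕜] b else 0 := by
    intro i k a ha b hb
    have : ∀ s ∈ Finset.HasAntidiagonal.antidiagonal j, TensorProduct.map (p s.1) (r s.2) (a ⊗ₜ[𝕜] b) =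
        if (i, k) = s then a ⊗ₜ[𝕜] b else 0 := by
      rintro ⟨s, t⟩ -
      rw [TensorProduct.map_tmul, hp i s a ha, hr k t b hb]
      by_cases h1 : i = s <;> by_cases h2 : k = t <;> simp [h1, h2]
    rw [LinearMap.sum_apply, Finset.sum_congr rfl this, Finset.sum_ite_eq]
    simp [Finset.HasAntidiagonal.mem_antidiagonal]
  have hid : kunneth 𝕜 𝒜 ℬ j ≤ LinearMap.eqLocus π LinearMap.id :=
    kunneth_le fun i k hik a ha b hb => by simp [LinearMap.mem_eqLocus, hπ i k a ha b hb, hik]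
  have hzero : (⨆ (m : ℕ) (_ : n < m), kunneth 𝕜 𝒜 ℬ m) ≤ LinearMap.ker π :=
    iSup₂_le fun m hm => kunneth_le fun i k hik a ha b hb => by
      rw [LinearMap.mem_ker, hπ i k a ha b hb, if_neg (by omega)]
  rw [Submodule.disjoint_def]
  intro x hx hx'
  rw [← show π x = x from hid hx]
  exact hzero hx'

end Kunneth

section IdealSpan

variable {𝕜 : Type} [Field 𝕜] {C : Type} [Ring C] [Algebra 𝕜 C] {s : Set C}

lemma subset_idealSpan {r : C} (hr : r ∈ s) : r ∈ idealSpan 𝕜 C s :=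
  Submodule.subset_span ⟨1, 1, r, hr, by simp⟩

lemma mul_mem_idealSpan_left (c : C) {x : C} (hx : x ∈ idealSpan 𝕜 C s) :
    c * x ∈ idealSpan 𝕜 C s := by
  revert x
  change idealSpan 𝕜 C s ≤ (idealSpan 𝕜 C s).comap (LinearMap.mulLeft 𝕜 c)
  refine Submodule.span_le.2 ?_
  rintro _ ⟨e, d, r, hr, rfl⟩
  exact Submodule.subset_span ⟨c * e, d, r, hr, by simp [mul_assoc]⟩

lemma mul_mem_idealSpan_right (c : C) {x : C} (hx : x ∈ idealSpan 𝕜 C s) :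
    x * c ∈ idealSpan 𝕜 C s := by
  revert x
  change idealSpan 𝕜 C s ≤ (idealSpan 𝕜 C s).comap (LinearMap.mulRight 𝕜 c)
  refine Submodule.span_le.2 ?_
  rintro _ ⟨e, d, r, hr, rfl⟩
  exact Submodule.subset_span ⟨e, d * c, r, hr, by simp [mul_assoc]⟩

lemma eq_zero_of_mem_idealSpan {D : Type} [Ring D] [Algebra 𝕜 D] (φ : C →ₐ[𝕜] D)
    (h : ∀ r ∈ s, φ r = 0) {x : C} (hx : x ∈ idealSpan 𝕜 C s) : φ x = 0 := by
  revert x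
  change idealSpan 𝕜 C s ≤ LinearMap.ker φ.toLinearMap
  refine Submodule.span_le.2 ?_
  rintro _ ⟨e, d, r, hr, rfl⟩
  simp [h r hr]

end IdealSpan

section Presentation

variable {𝕜 : Type} [Field 𝕜] {A B : Type} [Ring A] [Algebra 𝕜 A] [Ring B] [Algebra 𝕜 B]
variable {𝒜 : ℕ → Submodule 𝕜 A} {ℬ : ℕ → Submodule 𝕜 B}
variable {P : Type} [Ring P] [Algebra 𝕜 P] {ιA : A →ₐ[𝕜] P} {ιB : B →ₐ[𝕜] P}
variable {τ : B ⊗[𝕜] A →ₗ[𝕜] A ⊗[𝕜] B}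

lemma one_tmul_one_mem_kunneth [GradedAlgebra 𝒜] [GradedAlgebra ℬ] :
    (1 : A) ⊗ₜ[𝕜] (1 : B) ∈ kunneth 𝕜 𝒜 ℬ 0 := by
  have := tmul_mem_kunneth (𝕜 := 𝕜) (SetLike.one_mem_graded 𝒜) (SetLike.one_mem_graded ℬ)
  rwa [add_zero] at this

lemma mulTau_tmul (a a' : A) (b b' : B) :
    mulTau 𝕜 A B τ ((a ⊗ₜ[𝕜] b) ⊗ₜ[𝕜] (a' ⊗ₜ[𝕜] b')) =
      TensorProduct.map (LinearMap.mulLeft 𝕜 a) (LinearMap.mulRight 𝕜 b') (τ (b ⊗ₜ[𝕜] a')) := by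
  simp only [mulTau, LinearMap.comp_apply, LinearEquiv.coe_coe, TensorProduct.assoc_tmul,
    LinearMap.lTensor_tmul, TensorProduct.assoc_symm_tmul, LinearMap.rTensor_tmul]
  induction τ (b ⊗ₜ[𝕜] a') with
  | zero => simp
  | tmul x y => simp
  | add x y hx hy => simp only [TensorProduct.add_tmul, TensorProduct.tmul_add, map_add, hx, hy]

@[simp]
lemma mulMapP_tmul (a : A) (b : B) : mulMapP 𝕜 A B P ιA ιB (a ⊗ₜ[𝕜] b) = ιA a * ιB b := rfl

lemma mulMapP_map_mulLeft_mulRight (a : A) (b : B) (x : A ⊗[𝕜] B) :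
    mulMapP 𝕜 A B P ιA ιB
        (TensorProduct.map (LinearMap.mulLeft 𝕜 a) (LinearMap.mulRight 𝕜 b) x) =
      ιA a * mulMapP 𝕜 A B P ιA ιB x * ιB b := by
  induction x with
  | zero => simp
  | tmul c d => simp [mul_assoc]
  | add x y hx hy => simp only [map_add, hx, hy, mul_add, add_mul]

lemma IsGradedMapBA.apply_tmul_mem (hτ : IsGradedMapBA 𝕜 A B 𝒜 ℬ τ) {i j : ℕ} {a : A} {b : B}
    (ha : a ∈ 𝒜 i) (hb : b ∈ ℬ j) : τ (b ⊗ₜ[𝕜] a) ∈ kunneth 𝕜 𝒜 ℬ (j + i) :=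
  hτ _ (Submodule.mem_map_of_mem (tmul_mem_kunneth hb ha))

lemma IsGradedMapBA.mulTau_tmul_mem [GradedAlgebra 𝒜] [GradedAlgebra ℬ]
    (hτ : IsGradedMapBA 𝕜 A B 𝒜 ℬ τ) {i j k l : ℕ} {a a' : A} {b b' : B}
    (ha : a ∈ 𝒜 i) (hb : b ∈ ℬ j) (ha' : a' ∈ 𝒜 k) (hb' : b' ∈ ℬ l) :
    mulTau 𝕜 A B τ ((a ⊗ₜ[𝕜] b) ⊗ₜ[𝕜] (a' ⊗ₜ[𝕜] b')) ∈ kunneth 𝕜 𝒜 ℬ (i + (j + k) + l) := by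
  rw [mulTau_tmul]
  exact map_mem_kunneth (fun _ _ h => SetLike.mul_mem_graded ha h)
    (fun _ _ h => SetLike.mul_mem_graded h hb') (hτ.apply_tmul_mem ha' hb)

/-- A multiplicative linear map out of `(A ⊗ B, μ_τ)` for which the unital conditions hold after
applying the map induces an algebra map from the free product that kills the `τ`-relations. -/
lemma exists_algHom_of_mulTau (hP : IsFreeProduct 𝕜 A B P ιA ιB)
    {Q : Type} [Ring Q] [Algebra 𝕜 Q] (q : A ⊗[𝕜] B →ₗ[𝕜] Q)
    (hq1 : q ((1 : A) ⊗ₜ[𝕜] (1 : B)) = 1)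
    (hqm : ∀ x y : A ⊗[𝕜] B, q (mulTau 𝕜 A B τ (x ⊗ₜ[𝕜] y)) = q x * q y)
    (hτ1 : τ ((1 : B) ⊗ₜ[𝕜] (1 : A)) = (1 : A) ⊗ₜ[𝕜] (1 : B))
    (hA : ∀ a a' : A, q (mulTau 𝕜 A B τ ((a ⊗ₜ[𝕜] 1) ⊗ₜ[𝕜] (a' ⊗ₜ[𝕜] 1))) =
      q ((a * a') ⊗ₜ[𝕜] 1))
    (hB : ∀ b b' : B, q (mulTau 𝕜 A B τ ((1 ⊗ₜ[𝕜] b) ⊗ₜ[𝕜] (1 ⊗ₜ[𝕜] b'))) =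
      q (1 ⊗ₜ[𝕜] (b * b'))) :
    ∃ φ : P →ₐ[𝕜] Q, (∀ a : A, φ (ιA a) = q (a ⊗ₜ[𝕜] (1 : B))) ∧
      (∀ b : B, φ (ιB b) = q ((1 : A) ⊗ₜ[𝕜] b)) ∧
      (∀ x, φ (mulMapP 𝕜 A B P ιA ιB x) = q x) ∧
      (∀ a b, φ (ιB b * ιA a - mulMapP 𝕜 A B P ιA ιB (τ (b ⊗ₜ[𝕜] a))) = 0) := by
  let f : A →ₐ[𝕜] Q := AlgHom.ofLinearMap (q ∘ₗ (TensorProduct.mk 𝕜 A B).flip 1)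
    (by simpa using hq1) (fun a a' => by simp [← hA, hqm])
  let g : B →ₐ[𝕜] Q := AlgHom.ofLinearMap (q ∘ₗ TensorProduct.mk 𝕜 A B 1)
    (by simpa using hq1) (fun b b' => by simp [← hB, hqm])
  obtain ⟨φ, ⟨hf, hg⟩, -⟩ := hP Q f g
  have hφA : ∀ a : A, φ (ιA a) = q (a ⊗ₜ[𝕜] (1 : B)) := fun a => DFunLike.congr_fun hf a
  have hφB : ∀ b : B, φ (ιB b) = q ((1 : A) ⊗ₜ[𝕜] b) := fun b => DFunLike.congr_fun hg b
  have hφm : ∀ x, φ (mulMapP 𝕜 A B P ιA ιB x) = q x := by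
    intro x
    induction x with
    | zero => simp
    | tmul a b =>
      rw [mulMapP_tmul, map_mul, hφA, hφB, ← hqm, mulTau_tmul, hτ1]
      simp
    | add x y hx hy => simp [hx, hy]
  refine ⟨φ, hφA, hφB, hφm, fun a b => ?_⟩
  rw [map_sub, hφm, map_mul, hφA, hφB, ← hqm, mulTau_tmul]
  simp [LinearMap.mulLeft_one, LinearMap.mulRight_one]

lemma freeProdGrade_le {n : ℕ} {S : Submodule 𝕜 P} (T : ℕ → Submodule 𝕜 P)
    (hT : T n ≤ S) (h0 : (1 : P) ∈ T 0)
    (hA : ∀ i j, i + j ≤ n → ∀ a ∈ 𝒜 i, ∀ x ∈ T j, ιA a * x ∈ T (i + j))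
    (hB : ∀ i j, i + j ≤ n → ∀ b ∈ ℬ i, ∀ x ∈ T j, ιB b * x ∈ T (i + j)) :
    freeProdGrade 𝕜 A B P ιA ιB 𝒜 ℬ n ≤ S := by
  refine iSup₂_le fun l hl => le_trans ?_ hT
  suffices H : ∀ l : List ℕ, l.sum ≤ n →
      (l.map (fun i => Submodule.map ιA.toLinearMap (𝒜 i) ⊔
        Submodule.map ιB.toLinearMap (ℬ i))).foldr (· * ·) 1 ≤ T l.sum by
    simpa only [hl] using H l hl.le
  intro l
  induction l with
  | nil => intro _; simpa [Submodule.one_le] using h0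
  | cons i l ih =>
    intro hi
    rw [List.sum_cons] at hi ⊢
    rw [List.map_cons, List.foldr_cons]
    refine Submodule.mul_le.2 fun y hy x hx => ?_
    have hx' := ih (by omega) hx
    obtain ⟨_, ⟨a, ha, rfl⟩, _, ⟨b, hb, rfl⟩, rfl⟩ := Submodule.mem_sup.1 hy
    rw [add_mul]
    exact (T _).add_mem (hA _ _ hi a ha x hx') (hB _ _ hi b hb x hx')

lemma map_mulMapP_kunneth_le (n : ℕ) :
    (kunneth 𝕜 𝒜 ℬ n).map (mulMapP 𝕜 A B P ιA ιB) ≤ freeProdGrade 𝕜 A B P ιA ιB 𝒜 ℬ n := by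
  refine Submodule.map_le_iff_le_comap.2 (kunneth_le fun i j hij a ha b hb => ?_)
  have h : (([i, j].map (fun i => Submodule.map ιA.toLinearMap (𝒜 i) ⊔
      Submodule.map ιB.toLinearMap (ℬ i))).foldr (· * ·) 1) ≤
        freeProdGrade 𝕜 A B P ιA ιB 𝒜 ℬ n :=
    le_iSup₂_of_le (f := fun (l : List ℕ) (_ : l.sum = n) =>
      ((l.map (fun i => Submodule.map ιA.toLinearMap (𝒜 i) ⊔
        Submodule.map ιB.toLinearMap (ℬ i))).foldr (· * ·) 1)) [i, j] (by simpa using hij) le_rfl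
  refine h ?_
  simp only [List.map_cons, List.map_nil, List.foldr_cons, List.foldr_nil, mul_one, mulMapP_tmul]
  exact Submodule.mul_mem_mul (Submodule.mem_sup_left ⟨a, ha, rfl⟩)
    (Submodule.mem_sup_right ⟨b, hb, rfl⟩)

lemma map_freeProdGrade_eq [GradedAlgebra 𝒜] [GradedAlgebra ℬ]
    (hτ : IsGradedMapBA 𝕜 A B 𝒜 ℬ τ)
    {Q : Type} [Ring Q] [Algebra 𝕜 Q] {q : A ⊗[𝕜] B →ₗ[𝕜] Q}
    (hqm : ∀ x y : A ⊗[𝕜] B, q (mulTau 𝕜 A B τ (x ⊗ₜ[𝕜] y)) = q x * q y)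
    {φ : P →ₐ[𝕜] Q} (hφA : ∀ a : A, φ (ιA a) = q (a ⊗ₜ[𝕜] (1 : B)))
    (hφB : ∀ b : B, φ (ιB b) = q ((1 : A) ⊗ₜ[𝕜] b))
    (hφm : ∀ x, φ (mulMapP 𝕜 A B P ιA ιB x) = q x) (n : ℕ) :
    Submodule.map φ.toLinearMap (freeProdGrade 𝕜 A B P ιA ιB 𝒜 ℬ n) =
      Submodule.map q (kunneth 𝕜 𝒜 ℬ n) := by
  have hmul : ∀ i j k, ∀ a ∈ 𝒜 i, ∀ b ∈ ℬ j, ∀ x : P,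
      φ x ∈ Submodule.map q (kunneth 𝕜 𝒜 ℬ k) →
      q (a ⊗ₜ[𝕜] b) * φ x ∈ Submodule.map q (kunneth 𝕜 𝒜 ℬ (i + j + k)) := by
    rintro i j k a ha b hb x ⟨y, hy, hyx⟩
    rw [← hyx, ← hqm]
    refine Submodule.mem_map_of_mem ?_
    revert y
    suffices kunneth 𝕜 𝒜 ℬ k ≤ (kunneth 𝕜 𝒜 ℬ (i + j + k)).comap
        (mulTau 𝕜 A B τ ∘ₗ TensorProduct.mk 𝕜 _ _ (a ⊗ₜ[𝕜] b)) from fun y hy _ => this hy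
    refine kunneth_le fun r s hrs c hc d hd => ?_
    have := hτ.mulTau_tmul_mem ha hb hc hd
    rwa [show i + (j + r) + s = i + j + k by omega] at this
  apply le_antisymm
  · refine Submodule.map_le_iff_le_comap.2 (freeProdGrade_le
      (fun j => (Submodule.map q (kunneth 𝕜 𝒜 ℬ j)).comap φ.toLinearMap) le_rfl ?_ ?_ ?_)
    · refine ⟨1 ⊗ₜ 1, one_tmul_one_mem_kunneth, ?_⟩
      rw [← hφm]
      simp
    · intro i j _ a ha x hx
      have := hmul i 0 j a ha 1 (SetLike.one_mem_graded ℬ) x hx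
      simpa [hφA] using this
    · intro i j _ b hb x hx
      have := hmul 0 i j 1 (SetLike.one_mem_graded 𝒜) b hb x hx
      simpa [hφB] using this
  · rw [show q = φ.toLinearMap ∘ₗ mulMapP 𝕜 A B P ιA ιB from LinearMap.ext fun x => (hφm x).symm,
      Submodule.map_comp]
    exact Submodule.map_mono (map_mulMapP_kunneth_le n)

lemma freeProdGrade_le_sup_idealSpan [GradedAlgebra 𝒜] [GradedAlgebra ℬ]
    (hτ : IsGradedMapBA 𝕜 A B 𝒜 ℬ τ) {j n : ℕ} (hj : j ≤ n) :
    freeProdGrade 𝕜 A B P ιA ιB 𝒜 ℬ j ≤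
      (kunneth 𝕜 𝒜 ℬ j).map (mulMapP 𝕜 A B P ιA ιB) ⊔
        idealSpan 𝕜 P (relSetLe 𝕜 A B P ιA ιB 𝒜 ℬ τ n) := by
  refine freeProdGrade_le (fun j => (kunneth 𝕜 𝒜 ℬ j).map (mulMapP 𝕜 A B P ιA ιB) ⊔
        idealSpan 𝕜 P (relSetLe 𝕜 A B P ιA ιB 𝒜 ℬ τ n)) le_rfl ?_ ?_ ?_
  · exact Submodule.mem_sup_left ⟨1 ⊗ₜ 1, one_tmul_one_mem_kunneth, by simp⟩
  · intro i k _ a ha x hx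
    obtain ⟨_, ⟨y, hy, rfl⟩, z, hz, rfl⟩ := Submodule.mem_sup.1 hx
    rw [mul_add]
    have hmem := map_mem_kunneth (k := 0)
      (f := LinearMap.mulLeft 𝕜 a) (g := LinearMap.mulRight 𝕜 (1 : B))
      (fun _ _ h => SetLike.mul_mem_graded ha h) (fun _ _ h => by simpa using h) hy
    rw [add_zero] at hmem
    refine Submodule.add_mem_sup ⟨_, hmem, ?_⟩ (mul_mem_idealSpan_left _ hz)
    rw [mulMapP_map_mulLeft_mulRight, map_one, mul_one]
  · intro i k hik b hb x hx
    obtain ⟨_, ⟨y, hy, rfl⟩, z, hz, rfl⟩ := Submodule.mem_sup.1 hx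
    rw [mul_add]
    refine Submodule.add_mem _ ?_ (Submodule.mem_sup_right (mul_mem_idealSpan_left _ hz))
    revert y
    suffices kunneth 𝕜 𝒜 ℬ k ≤ ((kunneth 𝕜 𝒜 ℬ (i + k)).map (mulMapP 𝕜 A B P ιA ιB) ⊔
        idealSpan 𝕜 P (relSetLe 𝕜 A B P ιA ιB 𝒜 ℬ τ n)).comap
        (LinearMap.mulLeft 𝕜 (ιB b) ∘ₗ mulMapP 𝕜 A B P ιA ιB) from fun y hy _ => this hy
    refine kunneth_le fun r s hrs c hc d hd => ?_
    have hrel : ιB b * ιA c - mulMapP 𝕜 A B P ιA ιB (τ (b ⊗ₜ[𝕜] c)) ∈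
        relSetLe 𝕜 A B P ιA ιB 𝒜 ℬ τ n := ⟨r, i, c, b, by omega, hc, hb, rfl⟩
    have hmem : TensorProduct.map (LinearMap.mulLeft 𝕜 1) (LinearMap.mulRight 𝕜 d)
        (τ (b ⊗ₜ[𝕜] c)) ∈ kunneth 𝕜 𝒜 ℬ (i + k) := by
      have := map_mem_kunneth (i := 0)
        (f := LinearMap.mulLeft 𝕜 1) (g := LinearMap.mulRight 𝕜 d)
        (fun _ _ h => by simpa using h) (fun _ _ h => SetLike.mul_mem_graded h hd)
        (hτ.apply_tmul_mem hc hb)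
      rwa [show 0 + (i + r) + s = i + k by omega] at this
    refine Submodule.mem_sup.2 ⟨_, ⟨_, hmem, rfl⟩, _,
      mul_mem_idealSpan_right (ιB d) (subset_idealSpan hrel), ?_⟩
    rw [mulMapP_map_mulLeft_mulRight]
    simp [sub_mul, mul_assoc]

lemma IsFreeProduct.adjoin_eq_top (hP : IsFreeProduct 𝕜 A B P ιA ιB) :
    Algebra.adjoin 𝕜 (Set.range ιA ∪ Set.range ιB) = ⊤ := by
  set S := Algebra.adjoin 𝕜 (Set.range ιA ∪ Set.range ιB) with hS
  obtain ⟨h, ⟨hA, hB⟩, -⟩ := hP S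
    (ιA.codRestrict S fun a => Algebra.subset_adjoin (Or.inl ⟨a, rfl⟩))
    (ιB.codRestrict S fun b => Algebra.subset_adjoin (Or.inr ⟨b, rfl⟩))
  have hid : S.val.comp h = AlgHom.id 𝕜 P := by
    refine (hP P ιA ιB).unique ⟨?_, ?_⟩ ⟨AlgHom.id_comp _, AlgHom.id_comp _⟩
    · rw [AlgHom.comp_assoc, hA, AlgHom.val_comp_codRestrict]
    · rw [AlgHom.comp_assoc, hB, AlgHom.val_comp_codRestrict]
  refine eq_top_iff.2 fun x _ => ?_
  rw [← show ((h x : S) : P) = x from DFunLike.congr_fun hid x]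
  exact (h x).2

lemma range_mulMapP_sup_idealSpan_eq_top (hP : IsFreeProduct 𝕜 A B P ιA ιB) :
    LinearMap.range (mulMapP 𝕜 A B P ιA ιB) ⊔
      idealSpan 𝕜 P (relSetAll 𝕜 A B P ιA ιB τ) = ⊤ := by
  set N := LinearMap.range (mulMapP 𝕜 A B P ιA ιB) ⊔
      idealSpan 𝕜 P (relSetAll 𝕜 A B P ιA ιB τ) with hN
  have hA : ∀ a : A, ∀ x ∈ N, ιA a * x ∈ N := by
    intro a x hx
    obtain ⟨_, ⟨y, rfl⟩, z, hz, rfl⟩ := Submodule.mem_sup.1 hx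
    rw [mul_add]
    refine Submodule.add_mem_sup ⟨TensorProduct.map (LinearMap.mulLeft 𝕜 a)
      (LinearMap.mulRight 𝕜 1) y, ?_⟩ (mul_mem_idealSpan_left _ hz)
    rw [mulMapP_map_mulLeft_mulRight, map_one, mul_one]
  have hB : ∀ b : B, ∀ x ∈ N, ιB b * x ∈ N := by
    intro b x hx
    obtain ⟨_, ⟨y, rfl⟩, z, hz, rfl⟩ := Submodule.mem_sup.1 hx
    rw [mul_add]
    refine Submodule.add_mem _ ?_ (Submodule.mem_sup_right (mul_mem_idealSpan_left _ hz))
    clear hx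
    induction y with
    | zero => simp
    | add y y' hy hy' => rw [map_add, mul_add]; exact N.add_mem hy hy'
    | tmul c d =>
      have hrel : ιB b * ιA c - mulMapP 𝕜 A B P ιA ιB (τ (b ⊗ₜ[𝕜] c)) ∈
          relSetAll 𝕜 A B P ιA ιB τ := ⟨c, b, rfl⟩
      refine Submodule.mem_sup.2 ⟨_, ⟨TensorProduct.map (LinearMap.mulLeft 𝕜 1)
        (LinearMap.mulRight 𝕜 d) (τ (b ⊗ₜ[𝕜] c)), rfl⟩, _,
        mul_mem_idealSpan_right (ιB d) (subset_idealSpan hrel), ?_⟩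
      rw [mulMapP_map_mulLeft_mulRight]
      simp [sub_mul, mul_assoc]
  have h1 : (1 : P) ∈ N := Submodule.mem_sup_left ⟨1 ⊗ₜ 1, by simp⟩
  have hmul : ∀ x : P, ∀ y ∈ N, x * y ∈ N := by
    intro x
    have hx : x ∈ Algebra.adjoin 𝕜 (Set.range ιA ∪ Set.range ιB) := by
      rw [hP.adjoin_eq_top]; trivial
    induction hx using Algebra.adjoin_induction with
    | mem x hx =>
      rcases hx with ⟨a, rfl⟩ | ⟨b, rfl⟩
      exacts [hA a, hB b]
    | algebraMap r =>
      intro y hy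
      rw [← Algebra.smul_def]
      exact N.smul_mem r hy
    | add x y _ _ hx hy =>
      intro z hz
      rw [add_mul]
      exact N.add_mem (hx z hz) (hy z hz)
    | mul x y _ _ hx hy =>
      intro z hz
      rw [mul_assoc]
      exact hx _ (hy z hz)
  exact eq_top_iff.2 fun x _ => by simpa using hmul x 1 h1

lemma TwistingToDeg.apply_mulTau_tmul_one [GradedAlgebra 𝒜] [GradedAlgebra ℬ] {n : ℕ}
    (hτ : TwistingToDeg 𝕜 A B 𝒜 ℬ τ n) {Q : Type} [Ring Q] [Algebra 𝕜 Q]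
    {q : A ⊗[𝕜] B →ₗ[𝕜] Q} (hq : ∀ m, n < m → kunneth 𝕜 𝒜 ℬ m ≤ LinearMap.ker q) (a a' : A) :
    q (mulTau 𝕜 A B τ ((a ⊗ₜ[𝕜] 1) ⊗ₜ[𝕜] (a' ⊗ₜ[𝕜] 1))) = q ((a * a') ⊗ₜ[𝕜] 1) := by
  induction a using DirectSum.Decomposition.inductionOn 𝒜 with
  | zero => simp
  | add x y hx hy => simp only [TensorProduct.add_tmul, map_add, hx, hy, add_mul]
  | @homogeneous i x =>
    induction a' using DirectSum.Decomposition.inductionOn 𝒜 with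
    | zero => simp
    | add y z hy hz =>
      simp only [TensorProduct.add_tmul, TensorProduct.tmul_add, map_add, hy, hz, mul_add]
    | @homogeneous j y =>
      have h1 := SetLike.one_mem_graded ℬ
      by_cases hj : j ≤ n
      · rw [mulTau_tmul, hτ.2.1 j hj y y.2]
        simp
      · rw [hq _ (by omega) (hτ.1.mulTau_tmul_mem x.2 h1 y.2 h1),
          hq _ (by omega) (tmul_mem_kunneth (SetLike.mul_mem_graded x.2 y.2) h1)]

lemma TwistingToDeg.apply_mulTau_one_tmul [GradedAlgebra 𝒜] [GradedAlgebra ℬ] {n : ℕ}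
    (hτ : TwistingToDeg 𝕜 A B 𝒜 ℬ τ n) {Q : Type} [Ring Q] [Algebra 𝕜 Q]
    {q : A ⊗[𝕜] B →ₗ[𝕜] Q} (hq : ∀ m, n < m → kunneth 𝕜 𝒜 ℬ m ≤ LinearMap.ker q) (b b' : B) :
    q (mulTau 𝕜 A B τ ((1 ⊗ₜ[𝕜] b) ⊗ₜ[𝕜] (1 ⊗ₜ[𝕜] b'))) = q (1 ⊗ₜ[𝕜] (b * b')) := by
  induction b using DirectSum.Decomposition.inductionOn ℬ with
  | zero => simp
  | add x y hx hy =>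
    simp only [TensorProduct.add_tmul, TensorProduct.tmul_add, map_add, hx, hy, add_mul]
  | @homogeneous i x =>
    induction b' using DirectSum.Decomposition.inductionOn ℬ with
    | zero => simp
    | add y z hy hz => simp only [TensorProduct.tmul_add, map_add, hy, hz, mul_add]
    | @homogeneous j y =>
      have h1 := SetLike.one_mem_graded 𝒜
      by_cases hi : i ≤ n
      · rw [mulTau_tmul, hτ.2.2.1 i hi x x.2]
        simp
      · rw [hq _ (by omega) (hτ.1.mulTau_tmul_mem h1 x.2 h1 y.2),
          hq _ (by omega) (tmul_mem_kunneth h1 (SetLike.mul_mem_graded x.2 y.2))]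

end Presentation

/-- Proposition 2.6 (`presentation`).  Let `A`, `B` be connected graded algebras with a
free product `(P, ιA, ιB)`, and let `τ : B ⊗ A → A ⊗ B` be a graded linear map.
(1) If `τ` is graded twisting to degree `n` then there is an algebra homomorphism
`φ : (A * B)/I_τⁿ → (A ⊗ B)/(A ⊗ B)_{>n}` (the target carrying the algebra structure
induced by `μ_τ`, encoded by a surjective multiplicative map `q` with kernel
`(A ⊗ B)_{>n}`), and `φ` is an isomorphism in degrees `≤ n`.
(2) If `τ` is a graded twisting map, then `A ⊗_τ B ≅ (A * B)/I_τ` as graded algebras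
(for any realization `(C, ψ)` of `A ⊗_τ B`). -/
theorem stmt1 (𝕜 : Type) [Field 𝕜] (A B : Type) [Ring A] [Algebra 𝕜 A] [Ring B] [Algebra 𝕜 B]
    (𝒜 : ℕ → Submodule 𝕜 A) (ℬ : ℕ → Submodule 𝕜 B)
    [GradedAlgebra 𝒜] [GradedAlgebra ℬ]
    (hconnA : 𝒜 0 = (1 : Submodule 𝕜 A)) (hconnB : ℬ 0 = (1 : Submodule 𝕜 B))
    (P : Type) [Ring P] [Algebra 𝕜 P] (ιA : A →ₐ[𝕜] P) (ιB : B →ₐ[𝕜] P)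
    (hP : IsFreeProduct 𝕜 A B P ιA ιB)
    (τ : B ⊗[𝕜] A →ₗ[𝕜] A ⊗[𝕜] B) :
    ((∀ (n : ℕ), TwistingToDeg 𝕜 A B 𝒜 ℬ τ n →
      ∀ (Q : Type) [Ring Q] [Algebra 𝕜 Q], ∀ q : A ⊗[𝕜] B →ₗ[𝕜] Q,
        Function.Surjective q →
        LinearMap.ker q = (⨆ (m : ℕ) (_ : n < m), kunneth 𝕜 𝒜 ℬ m) →
        q ((1 : A) ⊗ₜ[𝕜] (1 : B)) = 1 →
        (∀ x y : A ⊗[𝕜] B, q (mulTau 𝕜 A B τ (x ⊗ₜ[𝕜] y)) = q x * q y) →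
        ∃ φ : P →ₐ[𝕜] Q,
          (∀ a : A, φ (ιA a) = q (a ⊗ₜ[𝕜] (1 : B))) ∧
          (∀ b : B, φ (ιB b) = q ((1 : A) ⊗ₜ[𝕜] b)) ∧
          (∀ x ∈ idealSpan 𝕜 P (relSetLe 𝕜 A B P ιA ιB 𝒜 ℬ τ n), φ x = 0) ∧
          (∀ j ≤ n, Submodule.map φ.toLinearMap (freeProdGrade 𝕜 A B P ιA ιB 𝒜 ℬ j) =
            Submodule.map q (kunneth 𝕜 𝒜 ℬ j)) ∧
          (∀ j ≤ n, ∀ x ∈ freeProdGrade 𝕜 A B P ιA ιB 𝒜 ℬ j,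
            φ x = 0 → x ∈ idealSpan 𝕜 P (relSetLe 𝕜 A B P ιA ιB 𝒜 ℬ τ n))) ∧
     (IsGradedTwisting 𝕜 A B 𝒜 ℬ τ →
      ∀ (C : Type) [Ring C] [Algebra 𝕜 C], ∀ ψ : A ⊗[𝕜] B →ₗ[𝕜] C,
        Realizes 𝕜 A B τ C ψ →
        ∃ φ : P →ₐ[𝕜] C,
          (∀ a : A, φ (ιA a) = ψ (a ⊗ₜ[𝕜] (1 : B))) ∧
          (∀ b : B, φ (ιB b) = ψ ((1 : A) ⊗ₜ[𝕜] b)) ∧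
          Function.Surjective φ ∧
          (∀ x : P, φ x = 0 ↔ x ∈ idealSpan 𝕜 P (relSetAll 𝕜 A B P ιA ιB τ)) ∧
          (∀ j : ℕ, Submodule.map φ.toLinearMap (freeProdGrade 𝕜 A B P ιA ιB 𝒜 ℬ j) =
            Submodule.map ψ (kunneth 𝕜 𝒜 ℬ j)))) := by
  constructor
  · intro n hτ Q _ _ q _ hker hq1 hqm
    have hq : ∀ m, n < m → kunneth 𝕜 𝒜 ℬ m ≤ LinearMap.ker q := fun m hm =>
      hker ▸ le_iSup₂_of_le (f := fun (m : ℕ) (_ : n < m) => kunneth 𝕜 𝒜 ℬ m) m hm le_rfl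
    obtain ⟨φ, hφA, hφB, hφm, hφr⟩ := exists_algHom_of_mulTau hP q hq1 hqm
      (hτ.2.1 0 n.zero_le 1 (SetLike.one_mem_graded 𝒜))
      (hτ.apply_mulTau_tmul_one hq) (hτ.apply_mulTau_one_tmul hq)
    have hI : ∀ x ∈ idealSpan 𝕜 P (relSetLe 𝕜 A B P ιA ιB 𝒜 ℬ τ n), φ x = 0 := fun x hx =>
      eq_zero_of_mem_idealSpan φ (by rintro _ ⟨i, j, a, b, -, -, -, rfl⟩; exact hφr a b) hx
    refine ⟨φ, hφA, hφB, hI, fun j _ => map_freeProdGrade_eq hτ.1 hqm hφA hφB hφm j,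
      fun j hj x hx hφx => ?_⟩
    obtain ⟨_, ⟨y, hy, rfl⟩, z, hz, rfl⟩ :=
      Submodule.mem_sup.1 (freeProdGrade_le_sup_idealSpan hτ.1 hj hx)
    rw [map_add, hI z hz, add_zero, hφm] at hφx
    have hy0 : y = 0 := Submodule.disjoint_def.1 (kunneth_disjoint_iSup_gt 𝒜 ℬ hj) y hy
      (hker ▸ LinearMap.mem_ker.2 hφx)
    simpa [hy0] using hz
  · rintro ⟨⟨hτA, hτB, -⟩, hτ⟩ C _ _ ψ ⟨hbij, hψ1, hψm⟩
    obtain ⟨φ, hφA, hφB, hφm, hφr⟩ := exists_algHom_of_mulTau hP ψ hψ1 hψm (hτA 1)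
      (fun a a' => by rw [mulTau_tmul, hτA]; simp) (fun b b' => by rw [mulTau_tmul, hτB]; simp)
    have hI : ∀ x ∈ idealSpan 𝕜 P (relSetAll 𝕜 A B P ιA ιB τ), φ x = 0 := fun x hx =>
      eq_zero_of_mem_idealSpan φ (by rintro _ ⟨a, b, rfl⟩; exact hφr a b) hx
    refine ⟨φ, hφA, hφB, fun c => ?_, fun x => ⟨fun hφx => ?_, hI x⟩,
      fun j => map_freeProdGrade_eq hτ hψm hφA hφB hφm j⟩
    · obtain ⟨y, rfl⟩ := hbij.2 c
      exact ⟨_, hφm y⟩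
    · have hx : x ∈ LinearMap.range (mulMapP 𝕜 A B P ιA ιB) ⊔
          idealSpan 𝕜 P (relSetAll 𝕜 A B P ιA ιB τ) := by
        rw [range_mulMapP_sup_idealSpan_eq_top hP]
        trivial
      obtain ⟨_, ⟨y, rfl⟩, z, hz, rfl⟩ := Submodule.mem_sup.1 hx
      rw [map_add, hI z hz, add_zero, hφm] at hφx
      have hy0 : y = 0 := hbij.1 (by rw [hφx, map_zero])
      simpa [hy0] using hz

end TTP
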